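/- arXiv:2209.05983 — 2 statements merged into one kernel-verified Lean document; each statement's English description precedes it below -/
import Mathlib

section
/- Let F be a field of characteristic not 2 and let a, b be nonzero elements of F. The quaternion algebra (a,b/F) is a division ring if and only if its norm form N(x₀, x, y, z) = x₀² − a·x² − b·y² + a·b·z² is anisotropic over F, i.e. N(x₀, x, y, z) = 0 implies x₀ = x = y = z = 0. -/
open Quaternion

namespace QuaternionAlgebra

variable {F : Type*} [Field F] {a b : F}

theorem mul_star_eq_coe_norm (u : ℍ[F, a, b]) :
    u * star u = ((u.re ^ 2 - a * u.imI ^ 2 - b * u.imJ ^ 2 + a * b * u.imK ^ 2 : F) :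
      ℍ[F, a, b]) := by
  rw [mul_star_eq_coe]
  congr 1
  simp
  ring

theorem isUnit_of_norm_ne_zero {u : ℍ[F, a, b]}
    (hu : u.re ^ 2 - a * u.imI ^ 2 - b * u.imJ ^ 2 + a * b * u.imK ^ 2 ≠ 0) : IsUnit u := by
  have h : IsUnit (u * star u) := by
    rw [mul_star_eq_coe_norm]
    exact (IsUnit.mk0 _ hu).map (algebraMap F ℍ[F, a, b])
  exact ((show Commute u (star u) from (star_comm_self' u).symm).isUnit_mul_iff.1 h).1

end QuaternionAlgebra

/-- For a field `F` of characteristic not 2 and nonzero `a b : F`,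
the quaternion algebra `(a,b/F)` is a division ring (every nonzero element is a unit)
iff the norm form `x₀² − a x² − b y² + a b z²` is anisotropic over `F`. -/
theorem quaternionAlgebra_isDivisionRing_iff_norm_anisotropic
    (F : Type*) [Field F] (hchar : (2 : F) ≠ 0) (a b : F) (ha : a ≠ 0) (hb : b ≠ 0) :
    (∀ u : ℍ[F, a, b], u ≠ 0 → IsUnit u) ↔
      (∀ x₀ x y z : F, x₀ ^ 2 - a * x ^ 2 - b * y ^ 2 + a * b * z ^ 2 = 0 →
        x₀ = 0 ∧ x = 0 ∧ y = 0 ∧ z = 0) := by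
  constructor
  · intro h x₀ x y z hN
    by_cases hu : (⟨x₀, x, y, z⟩ : ℍ[F, a, b]) = 0
    · simpa [QuaternionAlgebra.ext_iff] using hu
    · have hstar := QuaternionAlgebra.mul_star_eq_coe_norm (⟨x₀, x, y, z⟩ : ℍ[F, a, b])
      rw [hN, QuaternionAlgebra.coe_zero, (h _ hu).mul_right_eq_zero, star_eq_zero] at hstar
      exact absurd hstar hu
  · intro h u hu
    refine QuaternionAlgebra.isUnit_of_norm_ne_zero fun hN => hu ?_
    obtain ⟨h₀, hI, hJ, hK⟩ := h _ _ _ _ hN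
    exact QuaternionAlgebra.ext h₀ hI hJ hK
end

section
/- Let F be a field of characteristic not 2 and let a, b, a′, b′ be nonzero elements of F. The quaternion algebras (a,b/F) and (a′,b′/F) are isomorphic as F-algebras if and only if the ternary quadratic forms Q(x, y, z) = −a·x² − b·y² + a·b·z² and Q′(x, y, z) = −a′·x² − b′·y² + a′·b′·z² are similar, i.e. there exists a nonzero scalar c ∈ Fˣ such that Q is equivalent (isometric) to the form c·Q′ over F. -/
open Quaternion

/-- Over a field of characteristic not 2, every algebra homomorphism from a quaternion algebra
to a nontrivial algebra is injective. -/
theorem QuaternionAlgebra.algHom_injective {F A : Type*} [Field F] [Ring A] [Nontrivial A]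
    [Algebra F A] (hchar : (2 : F) ≠ 0) {a b : F} (ha : a ≠ 0) (hb : b ≠ 0)
    (φ : ℍ[F, a, b] →ₐ[F] A) : Function.Injective φ := by
  have re_eq_zero (q : ℍ[F, a, b]) (hq : φ q = 0) : q.re = 0 := by
    let i : ℍ[F, a, b] := ⟨0, 1, 0, 0⟩
    let j : ℍ[F, a, b] := ⟨0, 0, 1, 0⟩
    let k : ℍ[F, a, b] := ⟨0, 0, 0, 1⟩
    have average : q + a⁻¹ • (i * q * i) + b⁻¹ • (j * q * j) - (a * b)⁻¹ • (k * q * k) =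
        algebraMap F _ (4 * q.re) := by
      ext <;> simp [i, j, k, QuaternionAlgebra.algebraMap_eq] <;> field_simp <;> ring
    have h := congrArg φ average
    simp only [map_add, map_sub, map_smul, map_mul φ, hq, AlgHom.commutes, mul_zero, zero_mul,
      smul_zero, add_zero, sub_zero] at h
    have h4 : (4 : F) * q.re = 0 :=
      (FaithfulSMul.algebraMap_injective F A) (by rw [map_zero]; exact h.symm)
    have h4' : (4 : F) ≠ 0 := by
      rw [show (4 : F) = 2 * 2 by norm_num]
      exact mul_ne_zero hchar hchar
    exact (mul_eq_zero.mp h4).resolve_left h4'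
  rw [injective_iff_map_eq_zero]
  intro q hq
  have hi := re_eq_zero (⟨0, 1, 0, 0⟩ * q) (by rw [map_mul, hq, mul_zero])
  have hj := re_eq_zero (⟨0, 0, 1, 0⟩ * q) (by rw [map_mul, hq, mul_zero])
  have hk := re_eq_zero (⟨0, 0, 0, 1⟩ * q) (by rw [map_mul, hq, mul_zero])
  simp [ha, hb] at hi hj hk
  ext <;> simp [re_eq_zero q hq, hi, hj, hk]

/-- A nonscalar quaternion with scalar square is pure. -/
theorem QuaternionAlgebra.re_eq_zero_of_sq_eq_algebraMap {F : Type*} [Field F]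
    (hchar : (2 : F) ≠ 0) {a b r : F} {q : ℍ[F, a, b]}
    (hq : q * q = algebraMap F _ r) (hq' : ∀ s : F, q ≠ algebraMap F _ s) : q.re = 0 := by
  by_contra hre
  have cancel (x : F) (h : q.re * x + x * q.re = 0) : x = 0 := by
    have : 2 * q.re * x = 0 := by linear_combination h
    exact (mul_eq_zero.mp this).resolve_left (mul_ne_zero hchar hre)
  refine hq' q.re ?_
  have hI := congrArg QuaternionAlgebra.imI hq
  have hJ := congrArg QuaternionAlgebra.imJ hq
  have hK := congrArg QuaternionAlgebra.imK hq
  simp only [QuaternionAlgebra.imI_mul, QuaternionAlgebra.imJ_mul, QuaternionAlgebra.imK_mul,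
    QuaternionAlgebra.algebraMap_eq] at hI hJ hK
  rw [QuaternionAlgebra.algebraMap_eq]
  ext
  · rfl
  · exact cancel _ (by linear_combination hI)
  · exact cancel _ (by linear_combination hJ)
  · exact cancel _ (by linear_combination hK)

/-- An isomorphism of quaternion algebras induces an isometry between the norm forms on pure
quaternions. -/
theorem QuaternionAlgebra.exists_isometry_of_algEquiv {F : Type*} [Field F]
    (hchar : (2 : F) ≠ 0) {a b a' b' : F} (f : ℍ[F, a, b] ≃ₐ[F] ℍ[F, a', b']) :
    ∃ e : (Fin 3 → F) ≃ₗ[F] (Fin 3 → F), ∀ v : Fin 3 → F,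
      -a * (v 0) ^ 2 - b * (v 1) ^ 2 + a * b * (v 2) ^ 2 =
        -a' * (e v 0) ^ 2 - b' * (e v 1) ^ 2 + a' * b' * (e v 2) ^ 2 := by
  let pure : (Fin 3 → F) →ₗ[F] ℍ[F, a, b] :=
    { toFun v := ⟨0, v 0, v 1, v 2⟩
      map_add' v w := by ext <;> simp
      map_smul' r v := by ext <;> simp }
  let coords : ℍ[F, a', b'] →ₗ[F] (Fin 3 → F) :=
    { toFun q := ![q.imI, q.imJ, q.imK]
      map_add' q r := by ext i; fin_cases i <;> simp
      map_smul' r q := by ext i; fin_cases i <;> simp }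
  have pure_sq (v : Fin 3 → F) : pure v * pure v =
      algebraMap F _ (a * v 0 ^ 2 + b * v 1 ^ 2 - a * b * v 2 ^ 2) := by
    rw [QuaternionAlgebra.algebraMap_eq]
    ext <;> simp [pure] <;> ring
  have map_sq (v : Fin 3 → F) : f (pure v) * f (pure v) =
      algebraMap F _ (a * v 0 ^ 2 + b * v 1 ^ 2 - a * b * v 2 ^ 2) := by
    rw [← map_mul, pure_sq, AlgEquiv.commutes]
  have re_map (v : Fin 3 → F) : (f (pure v)).re = 0 := by
    by_cases hv : v = 0
    · simp [hv]
    refine re_eq_zero_of_sq_eq_algebraMap hchar (map_sq v) fun s hs ↦ hv ?_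
    rw [← f.commutes s] at hs
    have h := f.injective hs
    rw [QuaternionAlgebra.algebraMap_eq] at h
    have hI := congrArg QuaternionAlgebra.imI h
    have hJ := congrArg QuaternionAlgebra.imJ h
    have hK := congrArg QuaternionAlgebra.imK h
    ext i
    fin_cases i
    · exact hI
    · exact hJ
    · exact hK
  let g : (Fin 3 → F) →ₗ[F] (Fin 3 → F) := coords ∘ₗ f.toLinearMap ∘ₗ pure
  have g_inj : Function.Injective g := by
    rw [injective_iff_map_eq_zero]
    intro v hv
    have hI : (f (pure v)).imI = 0 := congrFun hv 0
    have hJ : (f (pure v)).imJ = 0 := congrFun hv 1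
    have hK : (f (pure v)).imK = 0 := congrFun hv 2
    have h0 : f (pure v) = 0 := by ext <;> simp [re_map, hI, hJ, hK]
    have h : pure v = 0 := f.injective (by rw [h0, map_zero])
    ext i
    fin_cases i
    · exact congrArg QuaternionAlgebra.imI h
    · exact congrArg QuaternionAlgebra.imJ h
    · exact congrArg QuaternionAlgebra.imK h
  refine ⟨LinearEquiv.ofInjectiveEndo g g_inj, fun v ↦ ?_⟩
  have h := congrArg QuaternionAlgebra.re (map_sq v)
  simp only [QuaternionAlgebra.re_mul, re_map, QuaternionAlgebra.algebraMap_eq] at h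
  change _ = -a' * (f (pure v)).imI ^ 2 - b' * (f (pure v)).imJ ^ 2 +
    a' * b' * (f (pure v)).imK ^ 2
  linear_combination h

/-- Anticommuting pure quaternions with nonzero squares `a` and `b`, given in coordinates, yield an
isomorphism from `ℍ[F, a, b]`. -/
theorem QuaternionAlgebra.nonempty_algEquiv_of_coords {F : Type*} [Field F]
    (hchar : (2 : F) ≠ 0) {a b a' b' : F} (ha : a ≠ 0) (hb : b ≠ 0) (u v : Fin 3 → F)
    (hu : a' * u 0 ^ 2 + b' * u 1 ^ 2 - a' * b' * u 2 ^ 2 = a)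
    (hv : a' * v 0 ^ 2 + b' * v 1 ^ 2 - a' * b' * v 2 ^ 2 = b)
    (huv : a' * u 0 * v 0 + b' * u 1 * v 1 - a' * b' * u 2 * v 2 = 0) :
    Nonempty (ℍ[F, a, b] ≃ₐ[F] ℍ[F, a', b']) := by
  let i : ℍ[F, a', b'] := ⟨0, u 0, u 1, u 2⟩
  let j : ℍ[F, a', b'] := ⟨0, v 0, v 1, v 2⟩
  let basis : QuaternionAlgebra.Basis ℍ[F, a', b'] a 0 b :=
    { i := i
      j := j
      k := i * j
      i_mul_i := by
        ext <;> simp [i]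
        · linear_combination hu
        all_goals ring
      j_mul_j := by
        ext <;> simp [j]
        · linear_combination hv
        all_goals ring
      i_mul_j := rfl
      j_mul_i := by
        ext <;> simp [i, j]
        · linear_combination 2 * huv
        all_goals ring }
  have inj := algHom_injective hchar ha hb basis.liftHom
  have surj : Function.Surjective basis.liftHom.toLinearMap :=
    (LinearMap.injective_iff_surjective_of_finrank_eq_finrank (by
      rw [finrank_eq_four, finrank_eq_four])).mp inj
  exact ⟨AlgEquiv.ofBijective basis.liftHom ⟨inj, surj⟩⟩

open Matrix in
/-- A linear map pulling back one diagonal quadratic form to another one satisfies the corresponding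
matrix congruence. -/
theorem Matrix.diagonal_congruence_of_forall_sum_sq {F : Type*} [Field F] (hchar : (2 : F) ≠ 0)
    {n : Type*} [Fintype n] [DecidableEq n] (d d' : n → F) (e : (n → F) →ₗ[F] (n → F))
    (h : ∀ v, ∑ i, d i * v i ^ 2 = ∑ i, d' i * e v i ^ 2) :
    diagonal d = (LinearMap.toMatrix' e)ᵀ * diagonal d' * LinearMap.toMatrix' e := by
  have polar (v w : n → F) : ∑ i, d i * v i * w i = ∑ i, d' i * e v i * e w i := by
    have expand (c x y : n → F) : ∑ i, c i * (x + y) i ^ 2 =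
        ∑ i, c i * x i ^ 2 + ∑ i, c i * y i ^ 2 + 2 * ∑ i, c i * x i * y i := by
      rw [Finset.mul_sum, ← Finset.sum_add_distrib, ← Finset.sum_add_distrib]
      exact Finset.sum_congr rfl fun i _ ↦ by rw [Pi.add_apply]; ring
    have hvw := h (v + w)
    rw [map_add, expand, expand] at hvw
    exact mul_left_cancel₀ hchar (by linear_combination hvw - h v - h w)
  ext i j
  have hij := polar (Pi.single i 1) (Pi.single j 1)
  rw [Matrix.mul_apply]
  simp only [mul_diagonal, transpose_apply, LinearMap.toMatrix'_apply]
  calc _ = ∑ k, d k * (Pi.single i 1 : n → F) k * (Pi.single j 1 : n → F) k := by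
        rcases eq_or_ne i j with rfl | hne <;> simp [Pi.single_apply, eq_comm, *]
    _ = _ := by
        rw [hij]
        exact Finset.sum_congr rfl fun k _ ↦ by ring

/-- For a field `F` of characteristic not 2 and nonzero `a b a' b' : F`,
the quaternion algebras `(a,b/F)` and `(a',b'/F)` are isomorphic as `F`-algebras iff
the ternary forms `−a x² − b y² + a b z²` and `−a' x² − b' y² + a' b' z²` are similar,
i.e. the first is equivalent to a nonzero scalar multiple of the second via an
invertible `F`-linear change of variables. -/
theorem quaternionAlgebra_iso_iff_ternary_forms_similar
    (F : Type*) [Field F] (hchar : (2 : F) ≠ 0) (a b a' b' : F)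
    (ha : a ≠ 0) (hb : b ≠ 0) (ha' : a' ≠ 0) (hb' : b' ≠ 0) :
    Nonempty (ℍ[F, a, b] ≃ₐ[F] ℍ[F, a', b']) ↔
      (∃ c : F, c ≠ 0 ∧ ∃ e : (Fin 3 → F) ≃ₗ[F] (Fin 3 → F),
        ∀ v : Fin 3 → F,
          -a * (v 0) ^ 2 - b * (v 1) ^ 2 + a * b * (v 2) ^ 2 =
            c * (-a' * (e v 0) ^ 2 - b' * (e v 1) ^ 2 + a' * b' * (e v 2) ^ 2)) := by
  constructor
  · rintro ⟨f⟩
    obtain ⟨e, he⟩ := QuaternionAlgebra.exists_isometry_of_algEquiv hchar f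
    exact ⟨1, one_ne_zero, e, fun v ↦ by rw [one_mul]; exact he v⟩
  · rintro ⟨c, hc, e, he⟩
    have hM := Matrix.diagonal_congruence_of_forall_sum_sq hchar ![-a, -b, a * b]
      ![c * -a', c * -b', c * (a' * b')] e.toLinearMap (fun v ↦ by
        simp only [Fin.sum_univ_three, LinearEquiv.coe_coe]
        simp only [Matrix.cons_val]
        linear_combination he v)
    set M := LinearMap.toMatrix' e.toLinearMap
    have hdet := congrArg Matrix.det hM
    simp only [Matrix.det_mul, Matrix.det_transpose, Matrix.det_diagonal, Fin.prod_univ_three,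
      Matrix.cons_val] at hdet
    have hdetM : M.det ≠ 0 := by
      intro h0
      rw [h0] at hdet
      have : (a * b) ^ 2 = 0 := by linear_combination hdet
      exact pow_ne_zero 2 (mul_ne_zero ha hb) this
    obtain ⟨t, ht⟩ : ∃ t : F, t ^ 2 = c := by
      refine ⟨a * b / (M.det * c * (a' * b')), ?_⟩
      rw [div_pow, div_eq_iff (by positivity)]
      linear_combination hdet
    have entry (i j : Fin 3) := congrFun (congrFun hM i) j
    simp only [Matrix.mul_apply (N := M), Matrix.mul_diagonal, Matrix.transpose_apply,
      Fin.sum_univ_three] at entry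
    have h00 := entry 0 0
    have h11 := entry 1 1
    have h01 := entry 0 1
    rw [Matrix.diagonal_apply_eq] at h00 h11
    rw [Matrix.diagonal_apply_ne _ (by decide)] at h01
    simp only [Matrix.cons_val] at h00 h11 h01
    subst ht
    refine QuaternionAlgebra.nonempty_algEquiv_of_coords hchar ha hb
      (fun i ↦ t * M i 0) (fun i ↦ t * M i 1) ?_ ?_ ?_
    · linear_combination h00
    · linear_combination h11
    · linear_combination h01
end
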